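/- arXiv:quant-ph/0406215 — 2 statements merged into one kernel-verified Lean document; each statement's English description precedes it below -/
import Mathlib

section
/- The quantum mutual entropy satisfies Shannon's fundamental inequality: 0 ≤ I(ρ; Λ*) ≤ S(ρ), where the upper bound is the von Neumann entropy of the input state. -/
open Matrix Kronecker
open scoped BigOperators ComplexOrder

variable {n m : Type*}

/-- Functional-calculus logarithm of a Hermitian matrix, restricted to its support
(zero eigenvalues are sent to zero). Returns 0 for non-Hermitian matrices. -/
noncomputable def matLog [Fintype n] [DecidableEq n] (A : Matrix n n ℂ) : Matrix n n ℂ :=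
  if h : A.IsHermitian then
    (h.eigenvectorUnitary : Matrix n n ℂ) *
      Matrix.diagonal (fun i => (Real.log (h.eigenvalues i) : ℂ)) *
      (star (h.eigenvectorUnitary : Matrix n n ℂ))
  else 0

/-- Extended Umegaki relative entropy `S(A,B) = Tr[A(log A − log B)]` (real part). -/
noncomputable def relEnt [Fintype n] [DecidableEq n] (A B : Matrix n n ℂ) : ℝ :=
  ((A * (matLog A - matLog B)).trace).re

/-- von Neumann entropy `S(ρ) = −Tr[ρ log ρ]`. -/
noncomputable def vnEnt [Fintype n] [DecidableEq n] (ρ : Matrix n n ℂ) : ℝ :=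
  -((ρ * matLog ρ).trace).re

/-- A density matrix: positive semidefinite with unit trace. -/
def IsDensity [Fintype n] [DecidableEq n] (ρ : Matrix n n ℂ) : Prop :=
  ρ.PosSemidef ∧ ρ.trace = 1

/-- Completely positive trace-preserving map, via a Kraus representation. -/
def IsCPTP [Fintype n] [DecidableEq n] [Fintype m] [DecidableEq m]
    (Λ : Matrix n n ℂ → Matrix m m ℂ) : Prop :=
  ∃ (ι : Type) (_ : Fintype ι) (K : ι → Matrix m n ℂ),
    (∀ A, Λ A = ∑ i, K i * A * (K i)ᴴ) ∧ (∑ i, (K i)ᴴ * K i = 1)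

/-- An orthogonal resolution of the identity (projection valued measure). -/
def OrthRes [Fintype n] [DecidableEq n] {ι : Type*} [Fintype ι]
    (E : ι → Matrix n n ℂ) : Prop :=
  (∀ i, (E i).IsHermitian) ∧ (∀ i, E i * E i = E i) ∧
  (∀ i j, i ≠ j → E i * E j = 0) ∧ (∑ i, E i = 1)

/-- A Schatten decomposition of ρ: rank-one orthogonal spectral projections. -/
def SchattenDecomp [Fintype n] [DecidableEq n]
    (ρ : Matrix n n ℂ) (lam : n → ℝ) (E : n → Matrix n n ℂ) : Prop :=
  (∀ k, 0 ≤ lam k) ∧ OrthRes E ∧ (∀ k, (E k).trace = 1) ∧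
  ρ = ∑ k, (lam k : ℂ) • E k

/-- Ohya's quantum mutual entropy `I(ρ;Λ*)`. -/
noncomputable def mutEnt [Fintype n] [DecidableEq n] [Fintype m] [DecidableEq m]
    (ρ : Matrix n n ℂ) (Λ : Matrix n n ℂ → Matrix m m ℂ) : ℝ :=
  sSup {x : ℝ | ∃ lam E, SchattenDecomp ρ lam E ∧
    x = ∑ k, lam k * relEnt (Λ (E k)) (Λ ρ)}

theorem matLog_eq [Fintype n] [DecidableEq n] {A : Matrix n n ℂ} (h : A.IsHermitian) :
    matLog A = (h.eigenvectorUnitary : Matrix n n ℂ) *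
      diagonal (fun i => (Real.log (h.eigenvalues i) : ℂ)) *
      (h.eigenvectorUnitary : Matrix n n ℂ)ᴴ :=
  dif_pos h

theorem ofReal_sum_eigenvalues [Fintype n] [DecidableEq n] {A : Matrix n n ℂ}
    (h : A.IsHermitian) : ((∑ i, h.eigenvalues i : ℝ) : ℂ) = A.trace := by
  rw [h.trace_eq_sum_eigenvalues, Complex.ofReal_sum]
  rfl

theorem eq_eigenvectorUnitary_conj [Fintype n] [DecidableEq n] {A : Matrix n n ℂ}
    (h : A.IsHermitian) :
    A = (h.eigenvectorUnitary : Matrix n n ℂ) *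
      diagonal (fun i => (h.eigenvalues i : ℂ)) *
      (h.eigenvectorUnitary : Matrix n n ℂ)ᴴ := by
  have := h.spectral_theorem
  rw [Unitary.conjStarAlgAut_apply] at this
  exact this

/-- The trace of a product of two matrices diagonal in different bases, in terms of the squared
overlaps of those bases. -/
theorem re_trace_conj_mul_conj [Fintype n] [DecidableEq n] (V U : Matrix n n ℂ) (a b : n → ℝ) :
    ((V * diagonal (fun i => (a i : ℂ)) * Vᴴ * (U * diagonal (fun i => (b i : ℂ)) * Uᴴ)).trace).re
      = ∑ l, ∑ i, a l * b i * Complex.normSq ((Vᴴ * U) l i) := by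
  have h : V * diagonal (fun i => (a i : ℂ)) * Vᴴ * (U * diagonal (fun i => (b i : ℂ)) * Uᴴ)
      = V * (diagonal (fun i => (a i : ℂ)) * (Vᴴ * U) * diagonal (fun i => (b i : ℂ)) * Uᴴ) := by
    simp only [Matrix.mul_assoc]
  have h' : diagonal (fun i => (a i : ℂ)) * (Vᴴ * U) * diagonal (fun i => (b i : ℂ)) * Uᴴ * V
      = diagonal (fun i => (a i : ℂ)) * (Vᴴ * U) * diagonal (fun i => (b i : ℂ)) * (Vᴴ * U)ᴴ := by
    simp only [Matrix.mul_assoc, conjTranspose_mul, conjTranspose_conjTranspose]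
  rw [h, trace_mul_comm, h']
  generalize Vᴴ * U = W
  simp only [trace, diag_apply, mul_apply (N := Wᴴ), mul_diagonal, diagonal_mul,
    conjTranspose_apply, Complex.re_sum]
  refine Finset.sum_congr rfl fun l _ => Finset.sum_congr rfl fun i _ => ?_
  have : (a l : ℂ) * W l i * (b i : ℂ) * star (W l i)
      = ((a l * b i * Complex.normSq (W l i) : ℝ) : ℂ) := by
    push_cast
    rw [← Complex.mul_conj]
    simp only [Complex.star_def]
    ring
  rw [this, Complex.ofReal_re]

theorem sum_normSq_row [Fintype n] [DecidableEq n] {W : Matrix n n ℂ} (hW : W * Wᴴ = 1) (l : n) :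
    ∑ i, Complex.normSq (W l i) = 1 := by
  have h := congrFun (congrFun hW l) l
  simp only [mul_apply, conjTranspose_apply, Complex.star_def, Complex.mul_conj,
    one_apply_eq] at h
  exact_mod_cast h

theorem sum_normSq_col [Fintype n] [DecidableEq n] {W : Matrix n n ℂ} (hW : Wᴴ * W = 1) (i : n) :
    ∑ l, Complex.normSq (W l i) = 1 := by
  have h := sum_normSq_row (W := Wᴴ) (by simpa using hW) i
  simpa using h

/-- The quadratic form of `τ - p • σ` at `U y`, with `σ` and `τ` diagonalised by `V` and `U`. -/
theorem posSemidef_diagonal_sub_conj [Fintype n] [DecidableEq n] {V U : Matrix n n ℂ}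
    (hU : Uᴴ * U = 1) {s μ : n → ℝ} {p : ℝ}
    (h : (U * diagonal (fun i => (μ i : ℂ)) * Uᴴ -
      (p : ℂ) • (V * diagonal (fun i => (s i : ℂ)) * Vᴴ)).PosSemidef) (y : n → ℂ) :
    p * ∑ l, s l * Complex.normSq (((Vᴴ * U) *ᵥ y) l) ≤ ∑ i, μ i * Complex.normSq (y i) := by
  have h1 := (h.conjTranspose_mul_mul_same U).dotProduct_mulVec_nonneg y
  have h2 : Uᴴ * (U * diagonal (fun i => (μ i : ℂ)) * Uᴴ -
      (p : ℂ) • (V * diagonal (fun i => (s i : ℂ)) * Vᴴ)) * U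
      = diagonal (fun i => (μ i : ℂ)) -
        (p : ℂ) • ((Vᴴ * U)ᴴ * diagonal (fun i => (s i : ℂ)) * (Vᴴ * U)) := by
    rw [mul_sub, sub_mul]
    congr 1
    · calc _ = (Uᴴ * U) * diagonal (fun i => (μ i : ℂ)) * (Uᴴ * U) := by
            simp only [Matrix.mul_assoc]
        _ = _ := by rw [hU, one_mul, mul_one]
    · simp [Matrix.mul_assoc]
  rw [h2] at h1
  generalize Vᴴ * U = W at h1 ⊢
  have key : ∀ (a : n → ℝ) (z : n → ℂ), star z ⬝ᵥ (diagonal (fun i => (a i : ℂ)) *ᵥ z)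
      = ((∑ i, a i * Complex.normSq (z i) : ℝ) : ℂ) := by
    intro a z
    push_cast
    refine Finset.sum_congr rfl fun i _ => ?_
    rw [mulVec_diagonal, ← Complex.mul_conj]
    simp only [Pi.star_apply, Complex.star_def]
    ring
  rw [sub_mulVec, dotProduct_sub, smul_mulVec, dotProduct_smul, key, ← mulVec_mulVec,
    ← mulVec_mulVec, dotProduct_mulVec, ← star_mulVec, key, smul_eq_mul, ← Complex.ofReal_mul,
    ← Complex.ofReal_sub, Complex.zero_le_real] at h1
  linarith

/-- The squared overlaps of the eigenbases of two Hermitian matrices. -/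
noncomputable def eigenOverlap [Fintype n] [DecidableEq n] {σ τ : Matrix n n ℂ}
    (hσ : σ.IsHermitian) (hτ : τ.IsHermitian) (l i : n) : ℝ :=
  Complex.normSq (((hσ.eigenvectorUnitary : Matrix n n ℂ)ᴴ *
    (hτ.eigenvectorUnitary : Matrix n n ℂ)) l i)

theorem eigenvectorUnitary_conjTranspose_mul [Fintype n] [DecidableEq n] {A : Matrix n n ℂ}
    (h : A.IsHermitian) :
    (h.eigenvectorUnitary : Matrix n n ℂ)ᴴ * (h.eigenvectorUnitary : Matrix n n ℂ) = 1 :=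
  Unitary.coe_star_mul_self h.eigenvectorUnitary

theorem conjTranspose_mul_mul_conjTranspose_self [Fintype n] [DecidableEq n] {V U : Matrix n n ℂ}
    (hV : Vᴴ * V = 1) (hU : Uᴴ * U = 1) : (Vᴴ * U) * (Vᴴ * U)ᴴ = 1 := by
  have hU' : U * Uᴴ = 1 := mul_eq_one_comm.mp hU
  calc _ = Vᴴ * (U * Uᴴ) * V := by simp [Matrix.mul_assoc]
    _ = 1 := by rw [hU', mul_one, hV]

section Overlap

variable [Fintype n] [DecidableEq n] {σ τ : Matrix n n ℂ}

theorem eigenOverlap_nonneg (hσ : σ.IsHermitian) (hτ : τ.IsHermitian) (l i : n) :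
    0 ≤ eigenOverlap hσ hτ l i :=
  Complex.normSq_nonneg _

theorem sum_eigenOverlap_row (hσ : σ.IsHermitian) (hτ : τ.IsHermitian) (l : n) :
    ∑ i, eigenOverlap hσ hτ l i = 1 :=
  sum_normSq_row (conjTranspose_mul_mul_conjTranspose_self
    (eigenvectorUnitary_conjTranspose_mul hσ) (eigenvectorUnitary_conjTranspose_mul hτ)) l

theorem sum_eigenOverlap_col (hσ : σ.IsHermitian) (hτ : τ.IsHermitian) (i : n) :
    ∑ l, eigenOverlap hσ hτ l i = 1 :=
  sum_normSq_col (mul_eq_one_comm.mp <| conjTranspose_mul_mul_conjTranspose_self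
    (eigenvectorUnitary_conjTranspose_mul hσ) (eigenvectorUnitary_conjTranspose_mul hτ)) i

theorem re_trace_mul_matLog_self {A : Matrix n n ℂ} (h : A.IsHermitian) :
    ((A * matLog A).trace).re = ∑ l, h.eigenvalues l * Real.log (h.eigenvalues l) := by
  rw [matLog_eq h]
  conv_lhs => enter [1, 1, 1]; rw [eq_eigenvectorUnitary_conj h]
  rw [re_trace_conj_mul_conj, eigenvectorUnitary_conjTranspose_mul]
  refine Finset.sum_congr rfl fun l _ => ?_
  rw [Finset.sum_eq_single l]
  · simp
  · intro i _ hi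
    simp [one_apply_ne' hi]
  · simp

theorem re_trace_mul_matLog (hσ : σ.IsHermitian) (hτ : τ.IsHermitian) :
    ((σ * matLog τ).trace).re =
      ∑ l, ∑ i, hσ.eigenvalues l * Real.log (hτ.eigenvalues i) * eigenOverlap hσ hτ l i := by
  rw [matLog_eq hτ]
  conv_lhs => enter [1, 1, 1]; rw [eq_eigenvectorUnitary_conj hσ]
  rw [re_trace_conj_mul_conj]
  rfl

theorem relEnt_eq (hσ : σ.IsHermitian) (hτ : τ.IsHermitian) :
    relEnt σ τ = ∑ l, ∑ i, hσ.eigenvalues l *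
      (Real.log (hσ.eigenvalues l) - Real.log (hτ.eigenvalues i)) * eigenOverlap hσ hτ l i := by
  rw [relEnt, mul_sub, trace_sub, Complex.sub_re, re_trace_mul_matLog_self hσ,
    re_trace_mul_matLog hσ hτ, ← Finset.sum_sub_distrib]
  refine Finset.sum_congr rfl fun l _ => ?_
  simp only [mul_sub, sub_mul, Finset.sum_sub_distrib]
  rw [← Finset.mul_sum, sum_eigenOverlap_row, mul_one]

theorem mul_sum_eigenvalues_mul_normSq_le (hσ : σ.IsHermitian) (hτ : τ.IsHermitian) {p : ℝ}
    (h : (τ - (p : ℂ) • σ).PosSemidef) (y : n → ℂ) :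
    p * ∑ l, hσ.eigenvalues l * Complex.normSq ((((hσ.eigenvectorUnitary : Matrix n n ℂ)ᴴ *
      (hτ.eigenvectorUnitary : Matrix n n ℂ)) *ᵥ y) l) ≤
      ∑ i, hτ.eigenvalues i * Complex.normSq (y i) := by
  refine posSemidef_diagonal_sub_conj (eigenvectorUnitary_conjTranspose_mul hτ) ?_ y
  rwa [← eq_eigenvectorUnitary_conj hτ, ← eq_eigenvectorUnitary_conj hσ]

theorem mul_eigenOverlap_le (hσ : σ.PosSemidef) (hτ : τ.IsHermitian) {p : ℝ} (hp : 0 < p)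
    (h : (τ - (p : ℂ) • σ).PosSemidef) (l i : n) :
    p * (hσ.1.eigenvalues l * eigenOverlap hσ.1 hτ l i) ≤ hτ.eigenvalues i := by
  have h1 := mul_sum_eigenvalues_mul_normSq_le hσ.1 hτ h (Pi.single i 1)
  have h2 : ∑ j, hτ.eigenvalues j * Complex.normSq ((Pi.single i 1 : n → ℂ) j)
      = hτ.eigenvalues i := by
    rw [Finset.sum_eq_single i]
    · simp
    · intro j _ hj
      simp [hj]
    · simp
  rw [h2] at h1
  refine le_trans (mul_le_mul_of_nonneg_left ?_ hp.le) h1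
  simp only [mulVec_single_one, col_apply]
  exact Finset.single_le_sum
    (f := fun l => hσ.1.eigenvalues l * eigenOverlap hσ.1 hτ l i)
    (fun l _ => mul_nonneg (hσ.eigenvalues_nonneg l) (eigenOverlap_nonneg _ _ l i))
    (Finset.mem_univ l)

/-- Eigenvectors of `σ` with nonzero eigenvalue are orthogonal to the kernel of `τ ≥ p • σ`. -/
theorem eigenvalues_mul_eigenOverlap_eq_zero (hσ : σ.PosSemidef) (hτ : τ.IsHermitian) {p : ℝ}
    (hp : 0 < p) (h : (τ - (p : ℂ) • σ).PosSemidef) (l : n) {i : n} (hi : hτ.eigenvalues i = 0) :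
    hσ.1.eigenvalues l * eigenOverlap hσ.1 hτ l i = 0 := by
  have h1 := mul_eigenOverlap_le hσ hτ hp h l i
  rw [hi] at h1
  exact le_antisymm (nonpos_of_mul_nonpos_right h1 hp)
    (mul_nonneg (hσ.eigenvalues_nonneg l) (eigenOverlap_nonneg _ _ l i))

theorem mul_sum_eigenOverlap_div_le_one (hσ : σ.PosSemidef) (hτ : τ.PosSemidef) {p : ℝ}
    (hp : 0 < p) (h : (τ - (p : ℂ) • σ).PosSemidef) (l : n) :
    p * hσ.1.eigenvalues l * ∑ i, eigenOverlap hσ.1 hτ.1 l i * (hτ.1.eigenvalues i)⁻¹ ≤ 1 := by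
  set W := (hσ.1.eigenvectorUnitary : Matrix n n ℂ)ᴴ * (hτ.1.eigenvectorUnitary : Matrix n n ℂ)
    with hW
  set t := ∑ i, eigenOverlap hσ.1 hτ.1 l i * (hτ.1.eigenvalues i)⁻¹ with ht
  have ht0 : 0 ≤ t := Finset.sum_nonneg fun i _ =>
    mul_nonneg (eigenOverlap_nonneg _ _ l i) (inv_nonneg.mpr (hτ.eigenvalues_nonneg i))
  have h1 := mul_sum_eigenvalues_mul_normSq_le hσ.1 hτ.1 h
    (fun i => starRingEnd ℂ (W l i) * ((hτ.1.eigenvalues i)⁻¹ : ℝ))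
  rw [← hW] at h1
  have h2 : ∑ i, hτ.1.eigenvalues i *
      Complex.normSq (starRingEnd ℂ (W l i) * ((hτ.1.eigenvalues i)⁻¹ : ℝ)) = t := by
    refine Finset.sum_congr rfl fun i _ => ?_
    rw [Complex.normSq_mul, Complex.normSq_conj, Complex.normSq_ofReal]
    change _ = Complex.normSq (W l i) * _
    rcases eq_or_ne (hτ.1.eigenvalues i) 0 with h0 | h0
    · simp [h0]
    · field_simp
  have h3 : (W *ᵥ fun i => starRingEnd ℂ (W l i) * ((hτ.1.eigenvalues i)⁻¹ : ℝ)) l = (t : ℂ) := by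
    rw [ht]
    push_cast
    refine Finset.sum_congr rfl fun i _ => ?_
    rw [← mul_assoc, Complex.mul_conj]
    rfl
  have h4 : hσ.1.eigenvalues l * (t * t) ≤ ∑ k, hσ.1.eigenvalues k * Complex.normSq
      ((W *ᵥ fun i => starRingEnd ℂ (W l i) * ((hτ.1.eigenvalues i)⁻¹ : ℝ)) k) := by
    rw [← Complex.normSq_ofReal, ← h3]
    exact Finset.single_le_sum (f := fun k => hσ.1.eigenvalues k * Complex.normSq
      ((W *ᵥ fun i => starRingEnd ℂ (W l i) * ((hτ.1.eigenvalues i)⁻¹ : ℝ)) k))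
      (fun k _ => mul_nonneg (hσ.eigenvalues_nonneg k) (Complex.normSq_nonneg _))
      (Finset.mem_univ l)
  rw [h2] at h1
  have h5 := (mul_le_mul_of_nonneg_left h4 hp.le).trans h1
  rcases ht0.eq_or_lt with h0 | h0
  · rw [← h0]
    simp
  · refine le_of_mul_le_mul_right ?_ h0
    linarith

/-- **Klein's inequality**, for `σ` dominated by a multiple of `τ`. -/
theorem relEnt_nonneg (hσ : σ.PosSemidef) (hτ : τ.PosSemidef) (htr : σ.trace = τ.trace) {p : ℝ}
    (hp : 0 < p) (h : (τ - (p : ℂ) • σ).PosSemidef) : 0 ≤ relEnt σ τ := by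
  have hsum : ∑ l, hσ.1.eigenvalues l = ∑ i, hτ.1.eigenvalues i := by
    rw [← ofReal_sum_eigenvalues hσ.1, ← ofReal_sum_eigenvalues hτ.1] at htr
    exact_mod_cast htr
  have h0 : ∑ l, ∑ i, (hσ.1.eigenvalues l - hτ.1.eigenvalues i) * eigenOverlap hσ.1 hτ.1 l i
      = 0 := by
    simp only [sub_mul, Finset.sum_sub_distrib]
    rw [Finset.sum_comm (f := fun l i => hτ.1.eigenvalues i * eigenOverlap hσ.1 hτ.1 l i)]
    simp only [← Finset.mul_sum, sum_eigenOverlap_row, sum_eigenOverlap_col, mul_one]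
    rw [hsum, sub_self]
  rw [relEnt_eq hσ.1 hτ.1, ← h0]
  refine Finset.sum_le_sum fun l _ => Finset.sum_le_sum fun i _ => ?_
  have hc := eigenOverlap_nonneg hσ.1 hτ.1 l i
  rcases (hτ.eigenvalues_nonneg i).eq_or_lt with hi | hi
  · have := eigenvalues_mul_eigenOverlap_eq_zero hσ hτ.1 hp h l hi.symm
    rw [← hi, mul_right_comm, this, sub_zero, this, zero_mul]
  rcases (hσ.eigenvalues_nonneg l).eq_or_lt with hl | hl
  · rw [← hl, zero_mul, zero_mul, zero_sub, neg_mul]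
    exact neg_nonpos.mpr (mul_nonneg hi.le hc)
  refine mul_le_mul_of_nonneg_right ?_ hc
  have hlog := Real.log_le_sub_one_of_pos (div_pos hi hl)
  rw [Real.log_div hi.ne' hl.ne'] at hlog
  have := mul_le_mul_of_nonneg_left hlog hl.le
  rw [mul_sub _ (_ / _), mul_div_cancel₀ _ hl.ne'] at this
  linarith

/-- If `p • σ ≤ τ` for a state `σ`, then `S(σ, τ) ≤ -log p`. -/
theorem relEnt_le_neg_log (hσ : σ.PosSemidef) (hτ : τ.PosSemidef) (htr : σ.trace = 1) {p : ℝ}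
    (hp : 0 < p) (h : (τ - (p : ℂ) • σ).PosSemidef) : relEnt σ τ ≤ -Real.log p := by
  have hsum : ∑ l, hσ.1.eigenvalues l = 1 := by
    rw [← ofReal_sum_eigenvalues hσ.1] at htr
    exact_mod_cast htr
  rw [relEnt_eq hσ.1 hτ.1, ← one_mul (-Real.log p), ← hsum, Finset.sum_mul]
  refine Finset.sum_le_sum fun l _ => ?_
  simp only [mul_assoc, ← Finset.mul_sum]
  rcases (hσ.eigenvalues_nonneg l).eq_or_lt with hl | hl
  · rw [← hl, zero_mul, zero_mul]
  refine mul_le_mul_of_nonneg_left ?_ hl.le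
  set w := p * hσ.1.eigenvalues l with hw
  have hw0 : 0 < w := mul_pos hp hl
  have hbound : ∀ i, (Real.log (hσ.1.eigenvalues l) - Real.log (hτ.1.eigenvalues i)) *
      eigenOverlap hσ.1 hτ.1 l i ≤ (-Real.log p - 1) * eigenOverlap hσ.1 hτ.1 l i +
        w * (eigenOverlap hσ.1 hτ.1 l i * (hτ.1.eigenvalues i)⁻¹) := by
    intro i
    have hc := eigenOverlap_nonneg hσ.1 hτ.1 l i
    rcases (hτ.eigenvalues_nonneg i).eq_or_lt with hi | hi
    · have := eigenvalues_mul_eigenOverlap_eq_zero hσ hτ.1 hp h l hi.symm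
      rw [(mul_eq_zero.mp this).resolve_left hl.ne']
      simp
    have hlog := Real.log_le_sub_one_of_pos (div_pos hw0 hi)
    rw [Real.log_div hw0.ne' hi.ne', hw, Real.log_mul hp.ne' hl.ne', ← hw, div_eq_mul_inv] at hlog
    nlinarith
  refine (Finset.sum_le_sum fun i _ => hbound i).trans ?_
  rw [Finset.sum_add_distrib, ← Finset.mul_sum, ← Finset.mul_sum, sum_eigenOverlap_row]
  have := mul_sum_eigenOverlap_div_le_one hσ hτ hp h l
  linarith

theorem vnEnt_nonneg {ρ : Matrix n n ℂ} (hρ : IsDensity ρ) : 0 ≤ vnEnt ρ := by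
  obtain ⟨hpos, htr⟩ := hρ
  have hsum : ∑ l, hpos.1.eigenvalues l = 1 := by
    rw [← ofReal_sum_eigenvalues hpos.1] at htr
    exact_mod_cast htr
  rw [vnEnt, re_trace_mul_matLog_self hpos.1, ← Finset.sum_neg_distrib]
  refine Finset.sum_nonneg fun l _ => ?_
  rw [← neg_mul]
  refine Real.negMulLog_nonneg (hpos.eigenvalues_nonneg l) ?_
  rw [← hsum]
  exact Finset.single_le_sum (fun i _ => hpos.eigenvalues_nonneg i) (Finset.mem_univ l)

theorem matLog_mul_of_mul_eq_smul {A E : Matrix n n ℂ} (h : A.IsHermitian) {a : ℝ}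
    (hE : A * E = (a : ℂ) • E) : matLog A * E = (Real.log a : ℂ) • E := by
  set U := (h.eigenvectorUnitary : Matrix n n ℂ) with hU
  have hUU : Uᴴ * U = 1 := eigenvectorUnitary_conjTranspose_mul h
  have hUU' : U * Uᴴ = 1 := mul_eq_one_comm.mp hUU
  have h1 : diagonal (fun i => (h.eigenvalues i : ℂ)) * (Uᴴ * E) = (a : ℂ) • (Uᴴ * E) := by
    rw [eq_eigenvectorUnitary_conj h, ← hU] at hE
    have := congrArg (Uᴴ * ·) hE
    simp only [← Matrix.mul_assoc, hUU, one_mul, Matrix.mul_smul] at this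
    simpa only [Matrix.mul_assoc] using this
  have h2 : diagonal (fun i => (Real.log (h.eigenvalues i) : ℂ)) * (Uᴴ * E)
      = (Real.log a : ℂ) • (Uᴴ * E) := by
    ext i j
    have h3 := congrFun (congrFun h1 i) j
    rw [diagonal_mul, Matrix.smul_apply, smul_eq_mul] at h3 ⊢
    rcases mul_eq_mul_right_iff.mp h3 with h4 | h4
    · rw [Complex.ofReal_inj.mp h4]
    · rw [h4, mul_zero, mul_zero]
  rw [matLog_eq h, ← hU, Matrix.mul_assoc, Matrix.mul_assoc, h2, Matrix.mul_smul, ← Matrix.mul_assoc,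
    hUU', one_mul]

theorem vnEnt_eq_of_schattenDecomp {ρ : Matrix n n ℂ} (hρ : ρ.IsHermitian) {lam : n → ℝ}
    {E : n → Matrix n n ℂ} (h : SchattenDecomp ρ lam E) :
    vnEnt ρ = ∑ k, lam k * -Real.log (lam k) := by
  obtain ⟨-, ⟨-, hidem, horth, -⟩, htr, hsum⟩ := h
  have hE : ∀ k, ρ * E k = (lam k : ℂ) • E k := by
    intro k
    rw [hsum, Finset.sum_mul, Finset.sum_eq_single k]
    · rw [smul_mul_assoc, hidem]
    · intro j _ hj
      rw [smul_mul_assoc, horth j k hj, smul_zero]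
    · simp
  have h1 : matLog ρ * ρ = ∑ k, ((lam k * Real.log (lam k) : ℝ) : ℂ) • E k := by
    conv_lhs => enter [2]; rw [hsum]
    rw [Finset.mul_sum]
    refine Finset.sum_congr rfl fun k _ => ?_
    rw [Matrix.mul_smul, matLog_mul_of_mul_eq_smul hρ (hE k), smul_smul, Complex.ofReal_mul]
  rw [vnEnt, trace_mul_comm, h1, trace_sum]
  simp only [trace_smul, htr, smul_eq_mul, mul_one, Complex.re_sum, Complex.ofReal_re, mul_neg,
    Finset.sum_neg_distrib]

end Overlap

section Channel

variable [Fintype n] [DecidableEq n] [Fintype m] [DecidableEq m] {Λ : Matrix n n ℂ → Matrix m m ℂ}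

theorem IsCPTP.posSemidef (hΛ : IsCPTP Λ) {A : Matrix n n ℂ} (hA : A.PosSemidef) :
    (Λ A).PosSemidef := by
  obtain ⟨ι, _, K, hK, -⟩ := hΛ
  rw [hK]
  exact posSemidef_sum _ fun i _ => hA.mul_mul_conjTranspose_same (K i)

theorem IsCPTP.trace_eq (hΛ : IsCPTP Λ) (A : Matrix n n ℂ) : (Λ A).trace = A.trace := by
  obtain ⟨ι, _, K, hK, hone⟩ := hΛ
  rw [hK, trace_sum]
  calc ∑ i, (K i * A * (K i)ᴴ).trace = ∑ i, ((K i)ᴴ * K i * A).trace :=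
        Finset.sum_congr rfl fun i _ => by rw [trace_mul_comm, ← Matrix.mul_assoc]
    _ = A.trace := by rw [← trace_sum, ← Finset.sum_mul, hone, one_mul]

theorem IsCPTP.map_sub_smul (hΛ : IsCPTP Λ) (A B : Matrix n n ℂ) (c : ℂ) :
    Λ (A - c • B) = Λ A - c • Λ B := by
  obtain ⟨ι, _, K, hK, -⟩ := hΛ
  simp only [hK, Finset.smul_sum, ← Finset.sum_sub_distrib]
  refine Finset.sum_congr rfl fun i _ => ?_
  rw [Matrix.mul_sub, Matrix.sub_mul, Matrix.mul_smul, Matrix.smul_mul]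

end Channel

theorem SchattenDecomp.posSemidef [Fintype n] [DecidableEq n] {ρ : Matrix n n ℂ} {lam : n → ℝ}
    {E : n → Matrix n n ℂ} (h : SchattenDecomp ρ lam E) (k : n) : (E k).PosSemidef := by
  obtain ⟨-, ⟨hherm, hidem, -, -⟩, -, -⟩ := h
  have := posSemidef_conjTranspose_mul_self (E k)
  rwa [(hherm k).eq, hidem] at this

theorem SchattenDecomp.posSemidef_sub [Fintype n] [DecidableEq n] {ρ : Matrix n n ℂ} {lam : n → ℝ}
    {E : n → Matrix n n ℂ} (h : SchattenDecomp ρ lam E) (k : n) :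
    (ρ - (lam k : ℂ) • E k).PosSemidef := by
  have hsum := h.2.2.2
  rw [← Finset.add_sum_erase _ _ (Finset.mem_univ k)] at hsum
  rw [hsum, add_sub_cancel_left]
  exact posSemidef_sum _ fun j _ => (h.posSemidef j).smul (Complex.zero_le_real.mpr (h.1 j))

theorem relEnt_map_mem_Icc [Fintype n] [DecidableEq n] [Fintype m] [DecidableEq m]
    {ρ : Matrix n n ℂ} (hρ : IsDensity ρ) {Λ : Matrix n n ℂ → Matrix m m ℂ} (hΛ : IsCPTP Λ)
    {lam : n → ℝ} {E : n → Matrix n n ℂ} (h : SchattenDecomp ρ lam E) {k : n} (hk : 0 < lam k) :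
    relEnt (Λ (E k)) (Λ ρ) ∈ Set.Icc 0 (-Real.log (lam k)) := by
  have hdom : (Λ ρ - (lam k : ℂ) • Λ (E k)).PosSemidef := by
    rw [← hΛ.map_sub_smul]
    exact hΛ.posSemidef (h.posSemidef_sub k)
  have htr : (Λ (E k)).trace = 1 := (hΛ.trace_eq _).trans (h.2.2.1 k)
  have htr' : (Λ ρ).trace = 1 := (hΛ.trace_eq _).trans hρ.2
  exact ⟨relEnt_nonneg (hΛ.posSemidef (h.posSemidef k)) (hΛ.posSemidef hρ.1)
      (htr.trans htr'.symm) hk hdom,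
    relEnt_le_neg_log (hΛ.posSemidef (h.posSemidef k)) (hΛ.posSemidef hρ.1) htr hk hdom⟩

/-- Shannon's fundamental inequality: `0 ≤ I(ρ;Λ*) ≤ S(ρ)`. -/
theorem stmt5_fundamental_inequality [Fintype n] [DecidableEq n]
    [Fintype m] [DecidableEq m]
    (ρ : Matrix n n ℂ) (hρ : IsDensity ρ)
    (Λ : Matrix n n ℂ → Matrix m m ℂ) (hΛ : IsCPTP Λ) :
    0 ≤ mutEnt ρ Λ ∧ mutEnt ρ Λ ≤ vnEnt ρ := by
  constructor
  · refine Real.sSup_nonneg ?_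
    rintro x ⟨lam, E, h, rfl⟩
    refine Finset.sum_nonneg fun k _ => ?_
    rcases (h.1 k).eq_or_lt with hk | hk
    · rw [← hk, zero_mul]
    · exact mul_nonneg hk.le (relEnt_map_mem_Icc hρ hΛ h hk).1
  · refine Real.sSup_le ?_ (vnEnt_nonneg hρ)
    rintro x ⟨lam, E, h, rfl⟩
    rw [vnEnt_eq_of_schattenDecomp hρ.1.1 h]
    refine Finset.sum_le_sum fun k _ => ?_
    rcases (h.1 k).eq_or_lt with hk | hk
    · rw [← hk, zero_mul, zero_mul]
    · exact mul_le_mul_of_nonneg_left (relEnt_map_mem_Icc hρ hΛ h hk).2 hk.le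
end

section
/- (Holevo bound) Let σ = ∑_k λ_k σ_k be an ensemble of density matrices and {E_i} an orthogonal resolution of identity (projective measurement). Then the accessible classical mutual information is bounded by the Holevo quantity: ∑_i [−Tr(σE_i) log Tr(σE_i) + ∑_k λ_k Tr(σ_k E_i) log Tr(σ_k E_i)] ≤ S(σ) − ∑_k λ_k S(σ_k). -/
open Matrix Kronecker
open scoped BigOperators ComplexOrder

variable {n m : Type*}

theorem hasDerivAt_sum_mul_log_add {α : Type*} [Fintype α] {w x : α → ℝ}
    (hx : ∀ a, w a ≠ 0 → 0 < x a) {t : ℝ} (ht : 0 ≤ t) :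
    HasDerivAt (fun t => ∑ a, w a * Real.log (x a + t)) (∑ a, w a / (x a + t)) t := by
  refine HasDerivAt.fun_sum fun a _ => ?_
  by_cases ha : w a = 0
  · simpa [ha] using hasDerivAt_const t (0 : ℝ)
  · have hpos : x a + t ≠ 0 := by have := hx a ha; positivity
    have := (((hasDerivAt_id t).const_add (x a)).log hpos).const_mul (w a)
    simpa [div_eq_mul_inv] using this

theorem tendsto_sum_mul_log_add_sub_log {α : Type*} [Fintype α] (w x : α → ℝ) :
    Filter.Tendsto (fun t => ∑ a, w a * (Real.log (x a + t) - Real.log t))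
      Filter.atTop (nhds 0) := by
  have : Filter.Tendsto (fun t => ∑ a, w a * (Real.log (x a + t) - Real.log t))
      Filter.atTop (nhds (∑ a, w a * 0)) := by
    refine tendsto_finsetSum _ fun a _ => Filter.Tendsto.const_mul _ ?_
    simpa [add_comm] using Real.tendsto_log_comp_add_sub_log (x a)
  simpa using this

/-- An inequality between weighted resolvent sums `∑ w / (x + t)` integrates to an inequality
between weighted logarithms. -/
theorem sum_mul_log_le_of_sum_div_le {α β : Type*} [Fintype α] [Fintype β]
    {w x : α → ℝ} {p y : β → ℝ} (hx : ∀ a, w a ≠ 0 → 0 < x a) (hy : ∀ b, p b ≠ 0 → 0 < y b)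
    (hwp : ∑ a, w a = ∑ b, p b)
    (h : ∀ t : ℝ, 0 < t → ∑ b, p b / (y b + t) ≤ ∑ a, w a / (x a + t)) :
    ∑ a, w a * Real.log (x a) ≤ ∑ b, p b * Real.log (y b) := by
  set G : ℝ → ℝ := fun t => ∑ a, w a * Real.log (x a + t) - ∑ b, p b * Real.log (y b + t) with hG
  have hderiv : ∀ t : ℝ, 0 ≤ t →
      HasDerivAt G (∑ a, w a / (x a + t) - ∑ b, p b / (y b + t)) t :=
    fun t ht => (hasDerivAt_sum_mul_log_add hx ht).sub (hasDerivAt_sum_mul_log_add hy ht)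
  have hmono : MonotoneOn G (Set.Ici 0) := by
    refine monotoneOn_of_deriv_nonneg (convex_Ici 0)
      (fun t ht => (hderiv t ht).continuousAt.continuousWithinAt) ?_ ?_
    · intro t ht
      rw [interior_Ici] at ht
      exact (hderiv t (le_of_lt ht)).differentiableAt.differentiableWithinAt
    · intro t ht
      rw [interior_Ici] at ht
      rw [(hderiv t (le_of_lt ht)).deriv]
      linarith [h t ht]
  have hlim : Filter.Tendsto G Filter.atTop (nhds 0) := by
    have := (tendsto_sum_mul_log_add_sub_log w x).sub (tendsto_sum_mul_log_add_sub_log p y)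
    simp only [mul_sub, Finset.sum_sub_distrib, ← Finset.sum_mul, hwp] at this
    simpa [hG] using this
  have hle : G 0 ≤ 0 := ge_of_tendsto hlim <| by
    filter_upwards [Filter.eventually_ge_atTop 0] with t ht
    exact hmono Set.self_mem_Ici ht ht
  simpa [hG] using hle

section UnitaryOverlap

variable [Fintype n] [DecidableEq n]

theorem trace_mul_eq_sum_overlap (U V : Matrix n n ℂ) (f g : n → ℝ) :
    ((U * diagonal (fun a => (f a : ℂ)) * star U *
        (V * diagonal (fun b => (g b : ℂ)) * star V)).trace).re
      = ∑ a, ∑ b, f a * g b * Complex.normSq ((star U * V) a b) := by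
  have h : (U * diagonal (fun a => (f a : ℂ)) * star U *
      (V * diagonal (fun b => (g b : ℂ)) * star V)).trace
      = (diagonal (fun a => (f a : ℂ)) * (star U * V) * diagonal (fun b => (g b : ℂ)) *
        star (star U * V)).trace := by
    rw [star_mul, star_star]
    simp only [Matrix.mul_assoc]
    rw [Matrix.trace_mul_comm]
    simp only [Matrix.mul_assoc]
  rw [h, Matrix.trace, Complex.re_sum]
  refine Finset.sum_congr rfl fun a _ => ?_
  rw [Matrix.diag_apply, Matrix.mul_apply, Complex.re_sum]
  refine Finset.sum_congr rfl fun b _ => ?_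
  rw [Matrix.mul_diagonal, Matrix.diagonal_mul, Matrix.star_apply, Complex.star_def]
  simp [Complex.normSq_apply]
  ring

theorem trace_sandwich_eq_sum_overlap (X U V : Matrix n n ℂ) (f : n → ℝ)
    (hX : X.IsHermitian) (hV : V * star V = 1) :
    ((X * (U * diagonal (fun a => (f a : ℂ)) * star U) * X).trace).re
      = ∑ a, ∑ b, f a * Complex.normSq ((star U * (X * V)) a b) := by
  have := trace_mul_eq_sum_overlap U (X * V) f 1
  simp only [Pi.one_apply, Complex.ofReal_one, mul_one] at this
  rw [← this, star_mul, show star X = X from hX,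
    show diagonal (fun _ : n => (1 : ℂ)) = 1 from Matrix.diagonal_one, Matrix.mul_one,
    show X * V * (star V * X) = X * (V * star V) * X by simp only [Matrix.mul_assoc], hV,
    Matrix.mul_one, Matrix.trace_mul_comm, ← Matrix.mul_assoc, Matrix.trace_mul_comm]

theorem trace_mul_eq_sum_cross_overlap (X U V : Matrix n n ℂ) (f : n → ℝ)
    (hV : V * star V = 1) :
    ((X * (U * diagonal (fun a => (f a : ℂ)) * star U)).trace).re
      = ∑ a, ∑ b, f a * ((star U * (X * V)) a b * star ((star U * V) a b)).re := by
  have h : (X * (U * diagonal (fun a => (f a : ℂ)) * star U)).trace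
      = (diagonal (fun a => (f a : ℂ)) * (star U * (X * V)) * star (star U * V)).trace := by
    rw [star_mul, star_star, show diagonal (fun a => (f a : ℂ)) * (star U * (X * V)) * (star V * U)
      = diagonal (fun a => (f a : ℂ)) * star U * X * (V * star V) * U by
        simp only [Matrix.mul_assoc], hV, Matrix.mul_one, Matrix.trace_mul_comm _ U,
      Matrix.trace_mul_comm]
    simp only [Matrix.mul_assoc]
  rw [h, Matrix.trace, Complex.re_sum]
  refine Finset.sum_congr rfl fun a _ => ?_
  rw [Matrix.diag_apply, Matrix.mul_apply, Complex.re_sum]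
  refine Finset.sum_congr rfl fun b _ => ?_
  rw [Matrix.diagonal_mul, Matrix.star_apply, mul_assoc, Complex.re_ofReal_mul]

end UnitaryOverlap

theorem div_div_add_eq_sq_div (p q t : ℝ) : p / (q / p + t) = p ^ 2 / (q + t * p) := by
  rcases eq_or_ne p 0 with rfl | hp
  · simp
  · rw [div_add' _ _ _ hp, div_div_eq_mul_div, sq]

theorem two_mul_re_sub_normSq_mul_le {r s t : ℝ} (hr : 0 ≤ r) (hs : 0 ≤ s) (ht : 0 < t)
    (z c : ℂ) :
    2 * (r * (z * star c).re) - (s * Complex.normSq z + t * (r * Complex.normSq z))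
      ≤ r ^ 2 / (s + t * r) * Complex.normSq c := by
  rcases hr.eq_or_lt with rfl | hr
  · have := mul_nonneg hs (Complex.normSq_nonneg z)
    simp only [mul_zero, zero_mul]
    norm_num
    linarith
  · have hd : 0 < s + t * r := by positivity
    rw [div_mul_eq_mul_div, le_div_iff₀ hd]
    simp only [Complex.normSq_apply, Complex.mul_re, Complex.star_def, Complex.conj_re,
      Complex.conj_im]
    nlinarith [sq_nonneg ((s + t * r) * z.re - r * c.re), sq_nonneg ((s + t * r) * z.im - r * c.im)]

theorem trace_sum_smul_mul_re {ι : Type*} [Fintype ι] [Fintype n] (E : ι → Matrix n n ℂ)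
    (x : ι → ℝ) (A : Matrix n n ℂ) :
    (((∑ i, (x i : ℂ) • E i) * A).trace).re = ∑ i, x i * ((A * E i).trace).re := by
  rw [Finset.sum_mul, Matrix.trace_sum, Complex.re_sum]
  refine Finset.sum_congr rfl fun i _ => ?_
  rw [Matrix.smul_mul, Matrix.trace_smul, smul_eq_mul, Complex.re_ofReal_mul,
    Matrix.trace_mul_comm]

theorem Matrix.PosSemidef.exists_spectral_matLog [Fintype n] [DecidableEq n] {A : Matrix n n ℂ}
    (hA : A.PosSemidef) :
    ∃ (U : Matrix n n ℂ) (r : n → ℝ), U * star U = 1 ∧ (∀ a, 0 ≤ r a) ∧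
      A = U * diagonal (fun a => (r a : ℂ)) * star U ∧
      matLog A = U * diagonal (fun a => (Real.log (r a) : ℂ)) * star U := by
  refine ⟨hA.1.eigenvectorUnitary, hA.1.eigenvalues, Unitary.coe_mul_star_self _,
    hA.eigenvalues_nonneg, ?_, by rw [matLog, dif_pos hA.1]⟩
  exact hA.1.spectral_theorem

section Measurement

variable [Fintype n] [DecidableEq n] {ι : Type*} [Fintype ι]

theorem OrthRes.sum_smul_mul_self {E : ι → Matrix n n ℂ} (hE : OrthRes E) (x : ι → ℝ) :
    (∑ i, (x i : ℂ) • E i) * (∑ i, (x i : ℂ) • E i) = ∑ i, ((x i ^ 2 : ℝ) : ℂ) • E i := by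
  classical
  rw [Finset.sum_mul]
  refine Finset.sum_congr rfl fun i _ => ?_
  rw [Finset.mul_sum, Finset.sum_eq_single i]
  · rw [smul_mul_smul_comm, hE.2.1]
    push_cast
    rw [sq]
  · intro j _ hj
    rw [smul_mul_smul_comm, hE.2.2.1 i j hj.symm, smul_zero]
  · simp

theorem OrthRes.isHermitian_sum_smul {E : ι → Matrix n n ℂ} (hE : OrthRes E) (x : ι → ℝ) :
    (∑ i, (x i : ℂ) • E i).IsHermitian := by
  rw [Matrix.IsHermitian, Matrix.conjTranspose_sum]
  refine Finset.sum_congr rfl fun i _ => ?_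
  rw [Matrix.conjTranspose_smul, (hE.1 i).eq]
  simp

theorem OrthRes.trace_mul_re_nonneg {E : ι → Matrix n n ℂ} (hE : OrthRes E)
    {A : Matrix n n ℂ} (hA : A.PosSemidef) (i : ι) : 0 ≤ ((A * E i).trace).re := by
  have h := (hA.conjTranspose_mul_mul_same (E i)).trace_nonneg
  rw [(hE.1 i).eq, Matrix.mul_assoc, Matrix.trace_mul_comm, Matrix.mul_assoc, hE.2.1] at h
  exact (Complex.le_def.1 h).1

theorem OrthRes.sum_trace_mul_re {E : ι → Matrix n n ℂ} (hE : OrthRes E) (A : Matrix n n ℂ) :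
    ∑ i, ((A * E i).trace).re = A.trace.re := by
  rw [← Complex.re_sum, ← Matrix.trace_sum, ← Finset.mul_sum, hE.2.2.2, Matrix.mul_one]

/-- Variational form of the monotonicity of the quasi-entropies `x ↦ (x + t)⁻¹` under a projective
measurement; the test operator is a real combination of the measurement projections. -/
theorem OrthRes.sum_sq_div_le {E : ι → Matrix n n ℂ} (hE : OrthRes E)
    {U V ρ σ : Matrix n n ℂ} {r s : n → ℝ} (hU : U * star U = 1) (hV : V * star V = 1)
    (hr : ∀ a, 0 ≤ r a) (hs : ∀ b, 0 ≤ s b)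
    (hρ : ρ = U * diagonal (fun a => (r a : ℂ)) * star U)
    (hσ : σ = V * diagonal (fun b => (s b : ℂ)) * star V)
    {t : ℝ} (ht : 0 < t) :
    ∑ i, ((ρ * E i).trace).re ^ 2 / (((σ * E i).trace).re + t * ((ρ * E i).trace).re)
      ≤ ∑ a, ∑ b, r a ^ 2 / (s b + t * r a) * Complex.normSq ((star U * V) a b) := by
  set p : ι → ℝ := fun i => ((ρ * E i).trace).re with hp_def
  set q : ι → ℝ := fun i => ((σ * E i).trace).re with hq_def
  set x : ι → ℝ := fun i => p i / (q i + t * p i) with hx_def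
  set X := ∑ i, (x i : ℂ) • E i with hX_def
  have hX : X.IsHermitian := hE.isHermitian_sum_smul x
  have hcross : ∑ i, x i * p i = ∑ a, ∑ b, r a *
      ((star U * (X * V)) a b * star ((star U * V) a b)).re := by
    rw [← trace_mul_eq_sum_cross_overlap X U V r hV, ← hρ, trace_sum_smul_mul_re]
  have hXAX : ∀ A : Matrix n n ℂ, ((X * A * X).trace).re = ∑ i, x i ^ 2 * ((A * E i).trace).re := by
    intro A
    rw [Matrix.trace_mul_comm, ← Matrix.mul_assoc, hE.sum_smul_mul_self, trace_sum_smul_mul_re]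
  have hρX : ∑ i, x i ^ 2 * p i
      = ∑ a, ∑ b, r a * Complex.normSq ((star U * (X * V)) a b) := by
    rw [← trace_sandwich_eq_sum_overlap X U V r hX hV, ← hρ, hXAX]
  have hσX : ∑ i, x i ^ 2 * q i
      = ∑ a, ∑ b, s b * Complex.normSq ((star U * (X * V)) a b) := by
    rw [← hXAX, hσ, trace_sandwich_eq_sum_overlap X V U s hX hU, Finset.sum_comm]
    refine Finset.sum_congr rfl fun a _ => Finset.sum_congr rfl fun b _ => ?_
    rw [← Complex.normSq_conj, ← Complex.star_def, ← Matrix.star_apply]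
    simp only [star_mul, star_star, show star X = X from hX, Matrix.mul_assoc]
  calc ∑ i, p i ^ 2 / (q i + t * p i)
      = 2 * ∑ i, x i * p i - (∑ i, x i ^ 2 * q i + t * ∑ i, x i ^ 2 * p i) := by
        simp only [Finset.mul_sum, ← Finset.sum_add_distrib, ← Finset.sum_sub_distrib]
        refine Finset.sum_congr rfl fun i _ => ?_
        rcases eq_or_ne (q i + t * p i) 0 with h | h
        · simp [hx_def, h]
        · simp only [hx_def]
          field_simp
          ring
    _ ≤ _ := by
        rw [hcross, hρX, hσX]
        simp only [Finset.mul_sum, ← Finset.sum_add_distrib, ← Finset.sum_sub_distrib]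
        exact Finset.sum_le_sum fun a _ => Finset.sum_le_sum fun b _ =>
          two_mul_re_sub_normSq_mul_le (hr a) (hs b) ht _ _

/-- Data processing: a projective measurement does not increase the relative entropy. -/
theorem OrthRes.sum_mul_log_sub_log_le_relEnt {E : ι → Matrix n n ℂ} (hE : OrthRes E)
    {ρ σ : Matrix n n ℂ} (hρ : ρ.PosSemidef) (hσ : σ.PosSemidef) {c : ℝ} (hc : 0 < c)
    (hdom : (σ - (c : ℂ) • ρ).PosSemidef) :
    ∑ i, ((ρ * E i).trace).re *
        (Real.log ((ρ * E i).trace).re - Real.log ((σ * E i).trace).re) ≤ relEnt ρ σ := by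
  obtain ⟨U, r, hU, hr, hρU, hlogρ⟩ := hρ.exists_spectral_matLog
  obtain ⟨V, s, hV, hs, hσV, hlogσ⟩ := hσ.exists_spectral_matLog
  have hp := hE.trace_mul_re_nonneg hρ
  have hpq : ∀ i, ((ρ * E i).trace).re ≠ 0 → 0 < ((σ * E i).trace).re := by
    intro i hi
    have h := hE.trace_mul_re_nonneg hdom i
    rw [Matrix.sub_mul, Matrix.smul_mul, Matrix.trace_sub, Matrix.trace_smul, smul_eq_mul,
      Complex.sub_re, Complex.re_ofReal_mul] at h
    have := mul_pos hc ((hp i).lt_of_ne' hi)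
    linarith
  set w : n × n → ℝ := fun ab => r ab.1 * Complex.normSq ((star U * V) ab.1 ab.2) with hw_def
  have hw_nonneg : ∀ ab, 0 ≤ w ab := fun ab => mul_nonneg (hr _) (Complex.normSq_nonneg _)
  have htrace_left : ∀ f : n → ℝ, ∑ ab : n × n, f ab.1 * Complex.normSq ((star U * V) ab.1 ab.2)
      = ((U * diagonal (fun a => (f a : ℂ)) * star U).trace).re := by
    intro f
    have := trace_mul_eq_sum_overlap U V f 1
    simp only [Pi.one_apply, Complex.ofReal_one, mul_one,
      show diagonal (fun _ : n => (1 : ℂ)) = 1 from Matrix.diagonal_one, hV] at this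
    rw [this, Fintype.sum_prod_type]
  have hw_pos : ∀ ab, w ab ≠ 0 → 0 < r ab.1 ∧ 0 < s ab.2 := by
    rintro ⟨a, b⟩ hab
    have hra : r a ≠ 0 := fun h => hab (by simp [hw_def, h])
    refine ⟨(hr a).lt_of_ne' hra, ?_⟩
    have hdiag : ((star V * ρ * V) b b).re = ∑ a, w (a, b) := by
      rw [hρU, show star V * (U * diagonal (fun a => (r a : ℂ)) * star U) * V
        = star (star U * V) * (diagonal (fun a => (r a : ℂ)) * (star U * V)) by
          simp only [star_mul, star_star, Matrix.mul_assoc], Matrix.mul_apply, Complex.re_sum]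
      refine Finset.sum_congr rfl fun a _ => ?_
      rw [Matrix.diagonal_mul, Matrix.star_apply, Complex.star_def, mul_left_comm,
        mul_comm ((starRingEnd ℂ) _), Complex.mul_conj, Complex.re_ofReal_mul, Complex.ofReal_re]
    have hdiagσ : star V * σ * V = diagonal (fun b => (s b : ℂ)) := by
      have hV' : star V * V = 1 := mul_eq_one_comm.1 hV
      rw [hσV, Matrix.mul_assoc, Matrix.mul_assoc, Matrix.mul_assoc, hV', Matrix.mul_one,
        ← Matrix.mul_assoc, hV', Matrix.one_mul]
    have h := (Complex.le_def.1 ((hdom.conjTranspose_mul_mul_same V).diag_nonneg (i := b))).1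
    rw [← Matrix.star_eq_conjTranspose, Matrix.mul_sub, Matrix.sub_mul, hdiagσ, Matrix.mul_smul,
      Matrix.smul_mul, Matrix.sub_apply, Matrix.smul_apply, Matrix.diagonal_apply_eq, smul_eq_mul,
      Complex.sub_re, Complex.re_ofReal_mul, hdiag] at h
    have hle := Finset.single_le_sum (f := fun a => w (a, b)) (fun a _ => hw_nonneg (a, b))
      (Finset.mem_univ a)
    have := mul_pos hc (((hw_nonneg (a, b)).lt_of_ne' hab).trans_le hle)
    simp only [Complex.zero_re, Complex.ofReal_re] at h
    linarith
  have hrel : relEnt ρ σ = - ∑ ab, w ab * Real.log (s ab.2 / r ab.1) := by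
    have hρρ : ((ρ * matLog ρ).trace).re = ∑ ab, w ab * Real.log (r ab.1) := by
      have hU' : star U * U = 1 := mul_eq_one_comm.1 hU
      have : ρ * matLog ρ = U * diagonal (fun a => ((r a * Real.log (r a) : ℝ) : ℂ)) * star U := by
        rw [hlogρ]
        conv_lhs => rw [hρU]
        calc _ = U * diagonal (fun a => (r a : ℂ)) * (star U * U) *
              diagonal (fun a => (Real.log (r a) : ℂ)) * star U := by
              simp only [Matrix.mul_assoc]
          _ = _ := by
              rw [hU', Matrix.mul_one, Matrix.mul_assoc U, Matrix.diagonal_mul_diagonal]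
              simp
      rw [this, ← htrace_left]
      exact Finset.sum_congr rfl fun ab _ => by simp only [hw_def]; ring
    have hρσ : ((ρ * matLog σ).trace).re = ∑ ab, w ab * Real.log (s ab.2) := by
      rw [hlogσ, hρU, trace_mul_eq_sum_overlap, Fintype.sum_prod_type]
      exact Finset.sum_congr rfl fun a _ => Finset.sum_congr rfl fun b _ => by
        simp only [hw_def]; ring
    rw [relEnt, Matrix.mul_sub, Matrix.trace_sub, Complex.sub_re, hρρ, hρσ,
      ← Finset.sum_sub_distrib, ← Finset.sum_neg_distrib]
    refine Finset.sum_congr rfl fun ab _ => ?_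
    by_cases hab : w ab = 0
    · simp [hab]
    · obtain ⟨h1, h2⟩ := hw_pos ab hab
      rw [Real.log_div h2.ne' h1.ne']
      ring
  have hmain := sum_mul_log_le_of_sum_div_le (w := w)
    (x := fun ab => s ab.2 / r ab.1)
    (p := fun i => ((ρ * E i).trace).re)
    (y := fun i => ((σ * E i).trace).re / ((ρ * E i).trace).re)
    (fun ab hab => div_pos (hw_pos ab hab).2 (hw_pos ab hab).1)
    (fun i hi => div_pos (hpq i hi) ((hp i).lt_of_ne' hi))
    (by rw [htrace_left, ← hρU, hE.sum_trace_mul_re])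
    (fun t ht => by
      refine le_trans (le_of_eq ?_) ((hE.sum_sq_div_le hU hV hr hs hρU hσV ht).trans
        (le_of_eq ?_))
      · refine Finset.sum_congr rfl fun i _ => ?_
        exact div_div_add_eq_sq_div _ _ _
      · rw [Fintype.sum_prod_type]
        refine Finset.sum_congr rfl fun a _ => Finset.sum_congr rfl fun b _ => ?_
        rw [← div_div_add_eq_sq_div, hw_def, mul_div_right_comm])
  rw [hrel, le_neg, ← Finset.sum_neg_distrib]
  refine hmain.trans (le_of_eq (Finset.sum_congr rfl fun i _ => ?_))
  by_cases hi : ((ρ * E i).trace).re = 0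
  · simp [hi]
  · rw [Real.log_div (hpq i hi).ne' hi]
    ring

end Measurement

/-- The Holevo bound: accessible information is bounded by the Holevo quantity. -/
theorem stmt10_holevo_bound {ι κ : Type*} [Fintype ι] [Fintype κ]
    [Fintype n] [DecidableEq n]
    (lam : κ → ℝ) (σs : κ → Matrix n n ℂ) (σ : Matrix n n ℂ)
    (hlam : ∀ k, 0 ≤ lam k) (hsum : ∑ k, lam k = 1)
    (hσs : ∀ k, IsDensity (σs k)) (hσ : σ = ∑ k, (lam k : ℂ) • σs k)
    (E : ι → Matrix n n ℂ) (hE : OrthRes E) :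
    ∑ i, (-(((σ * E i).trace).re * Real.log ((σ * E i).trace).re) +
        ∑ k, lam k * (((σs k * E i).trace).re * Real.log ((σs k * E i).trace).re))
      ≤ vnEnt σ - ∑ k, lam k * vnEnt (σs k) := by
  have hdom : ∀ k, (σ - (lam k : ℂ) • σs k).PosSemidef := by
    classical
    intro k
    rw [hσ, ← Finset.add_sum_erase _ _ (Finset.mem_univ k), add_sub_cancel_left]
    exact Matrix.posSemidef_sum _ fun j _ =>
      (hσs j).1.smul (Complex.zero_le_real.2 (hlam j))
  have hσ_pos : σ.PosSemidef := by
    rw [hσ]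
    exact Matrix.posSemidef_sum _ fun j _ =>
      (hσs j).1.smul (Complex.zero_le_real.2 (hlam j))
  have hmix : ∀ B : Matrix n n ℂ,
      ((σ * B).trace).re = ∑ k, lam k * ((σs k * B).trace).re := by
    intro B
    rw [hσ, Finset.sum_mul, Matrix.trace_sum, Complex.re_sum]
    refine Finset.sum_congr rfl fun k _ => ?_
    rw [Matrix.smul_mul, Matrix.trace_smul, smul_eq_mul, Complex.re_ofReal_mul]
  have hrel : vnEnt σ - ∑ k, lam k * vnEnt (σs k) = ∑ k, lam k * relEnt (σs k) σ := by
    simp only [vnEnt, relEnt, hmix (matLog σ), Matrix.trace_sub, Complex.sub_re,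
      mul_sub, mul_neg, Finset.sum_sub_distrib, Finset.sum_neg_distrib]
    ring
  have hinfo : ∑ i, (-(((σ * E i).trace).re * Real.log ((σ * E i).trace).re) +
        ∑ k, lam k * (((σs k * E i).trace).re * Real.log ((σs k * E i).trace).re))
      = ∑ k, lam k * ∑ i, ((σs k * E i).trace).re *
        (Real.log ((σs k * E i).trace).re - Real.log ((σ * E i).trace).re) := by
    simp only [Finset.mul_sum]
    rw [Finset.sum_comm]
    refine Finset.sum_congr rfl fun i _ => ?_
    nth_rw 1 [hmix (E i)]
    rw [Finset.sum_mul, neg_add_eq_sub, ← Finset.sum_sub_distrib]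
    exact Finset.sum_congr rfl fun k _ => by ring
  rw [hrel, hinfo]
  refine Finset.sum_le_sum fun k _ => ?_
  rcases (hlam k).eq_or_lt with hk | hk
  · simp [← hk]
  · exact mul_le_mul_of_nonneg_left
      (hE.sum_mul_log_sub_log_le_relEnt (hσs k).1 hσ_pos hk (hdom k)) hk.le
end
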